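/- Let N be a positive integer, Γ ⊆ ℤ/Nℤ a finite set of frequencies, δ ∈ (0,1] such that B(Γ,δ) is regular, 0 < δ' ≤ δ, κ > 0 and ε > 0. Let ℒ ⊆ ℤ/Nℤ be a finite set of frequencies, let S := {t ∈ ℤ/Nℤ : |β̂_{Γ,δ}(t)| ≥ κ}, and let Λ ⊆ ℒ be maximal with respect to inclusion among S-dissociated subsets of ℒ. Then for every t ∈ ℒ and every x ∈ B(Γ,δ') ∩ B(Λ,ε) one has |1 − e^{2πi t x/N}| ≤ 2⁵·|Γ|·κ⁻¹·δ'·δ⁻¹ + 2⁴·|Λ|·ε. -/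

import Mathlib

open Finset Complex
open scoped Pointwise BigOperators ComplexConjugate

/-- Distance from a real number to the nearest integer. -/
noncomputable def nint (r : ℝ) : ℝ := |r - round r|

open Classical in
/-- The Bohr set `B(Γ, δ)` in `ℤ/Nℤ`: all `x` with `‖t x / N‖ ≤ δ` for every frequency
`t ∈ Γ`, where `‖·‖` is the distance to the nearest integer. -/
noncomputable def bohr (N : ℕ) [NeZero N] (Γ : Finset (ZMod N)) (δ : ℝ) : Finset (ZMod N) :=
  Finset.univ.filter fun x => ∀ t ∈ Γ, nint (((t * x).val : ℝ) / N) ≤ δ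

/-- Regularity of the Bohr set `B(Γ, δ)`. -/
def BohrRegular (N : ℕ) [NeZero N] (Γ : Finset (ZMod N)) (δ : ℝ) : Prop :=
  ∀ η : ℝ, (Γ.card : ℝ) * |η| ≤ ((2 : ℝ) ^ 4)⁻¹ →
    (1 - 2 ^ 4 * Γ.card * |η|) * (bohr N Γ δ).card ≤ ((bohr N Γ ((1 + η) * δ)).card : ℝ) ∧
    ((bohr N Γ ((1 + η) * δ)).card : ℝ) ≤ (1 + 2 ^ 4 * Γ.card * |η|) * (bohr N Γ δ).card

/-- The character of `ℤ/Nℤ` associated with the frequency `t`, evaluated at `x`: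
`γ_t(x) = e^{2πi t x / N}`. -/
noncomputable def chr (N : ℕ) [NeZero N] (t x : ZMod N) : ℂ :=
  Complex.exp (2 * Real.pi * Complex.I * (((t * x).val : ℕ) : ℂ) / N)

/-- The Fourier transform of the uniform probability measure `β_{Γ,δ}` on `B(Γ,δ)` at the
frequency `t`: `β̂_{Γ,δ}(t) = |B(Γ,δ)|⁻¹ Σ_{x ∈ B(Γ,δ)} e^{-2πi t x / N}`. -/
noncomputable def bohrFourier (N : ℕ) [NeZero N] (Γ : Finset (ZMod N)) (δ : ℝ) (t : ZMod N) : ℂ :=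
  ((bohr N Γ δ).card : ℂ)⁻¹ *
    ∑ x ∈ bohr N Γ δ, Complex.exp (-(2 * Real.pi * Complex.I * (((t * x).val : ℕ) : ℂ) / N))

/-- A finite set `Λ` in an abelian group is `S`-dissociated if the only `{-1,0,1}`-valued
assignment `m` on `Λ` with `Σ_{λ ∈ Λ} m(λ)·λ ∈ S` is `m ≡ 0`. -/
def SDissociated {G : Type*} [AddCommGroup G] (S : Set G) (Λ : Finset G) : Prop :=
  ∀ m : G → ℤ, (∀ l ∈ Λ, m l = -1 ∨ m l = 0 ∨ m l = 1) →
    (∑ l ∈ Λ, m l • l) ∈ S → ∀ l ∈ Λ, m l = 0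

theorem aux_chr (N : ℕ) [NeZero N] (t x : ZMod N) : chr N t x = ZMod.stdAddChar (t * x) := by
  rw [ZMod.stdAddChar_apply, ZMod.toCircle_apply]; rfl

theorem aux_nint (N : ℕ) [NeZero N] (a : ZMod N) :
    nint ((a.val : ℝ) / N) = ‖ZMod.toAddCircle a‖ := by
  rw [ZMod.toAddCircle_apply, UnitAddCircle.norm_eq]; rfl

theorem aux_mem (N : ℕ) [NeZero N] (Γ : Finset (ZMod N)) (δ : ℝ) (x : ZMod N) :
    x ∈ bohr N Γ δ ↔ ∀ t ∈ Γ, ‖ZMod.toAddCircle (t * x)‖ ≤ δ := by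
  simp only [bohr, aux_nint, Finset.mem_filter, Finset.mem_univ, true_and]

theorem aux_norm (N : ℕ) [NeZero N] (a : ZMod N) :
    ‖1 - (ZMod.stdAddChar a : ℂ)‖ ≤ 2 * Real.pi * ‖ZMod.toAddCircle a‖ := by
  rw [← aux_nint, ZMod.stdAddChar_apply, ZMod.toCircle_apply]
  set r : ℝ := (a.val : ℝ) / N with hr
  have h1 : Complex.exp (2 * Real.pi * Complex.I * a.val / N)
      = Complex.exp (Complex.I * ((2 * Real.pi * (r - round r) : ℝ) : ℂ)) := by
    rw [Complex.exp_eq_exp_iff_exists_int]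
    refine ⟨round r, ?_⟩
    rw [hr]; push_cast; ring
  rw [h1, norm_sub_rev]
  refine (Real.norm_exp_I_mul_ofReal_sub_one_le).trans ?_
  rw [Real.norm_eq_abs, abs_mul, abs_of_pos Real.two_pi_pos]; rfl

theorem aux_norm1 (N : ℕ) [NeZero N] (a : ZMod N) : ‖(ZMod.stdAddChar a : ℂ)‖ = 1 := by
  simp

theorem aux_add (N : ℕ) [NeZero N] (a b : ZMod N) :
    ‖1 - (ZMod.stdAddChar (a + b) : ℂ)‖ ≤
      ‖1 - (ZMod.stdAddChar a : ℂ)‖ + ‖1 - (ZMod.stdAddChar b : ℂ)‖ := by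
  rw [AddChar.map_add_eq_mul]
  set u : ℂ := ZMod.stdAddChar a with hu
  set v : ℂ := ZMod.stdAddChar b
  have : 1 - u * v = (1 - u) + u * (1 - v) := by ring
  rw [this]
  refine (norm_add_le _ _).trans ?_
  rw [norm_mul, hu, aux_norm1, one_mul]

theorem aux_neg (N : ℕ) [NeZero N] (a : ZMod N) :
    ‖1 - (ZMod.stdAddChar (-a) : ℂ)‖ = ‖1 - (ZMod.stdAddChar a : ℂ)‖ := by
  have h : (ZMod.stdAddChar (-a) : ℂ) * ZMod.stdAddChar a = 1 := by
    rw [← AddChar.map_add_eq_mul]; simp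
  calc ‖1 - (ZMod.stdAddChar (-a) : ℂ)‖
      = ‖(1 - (ZMod.stdAddChar (-a) : ℂ)) * ZMod.stdAddChar a‖ := by
        rw [norm_mul, aux_norm1, mul_one]
    _ = _ := by rw [sub_mul, h, one_mul, norm_sub_rev]

theorem aux_sum (N : ℕ) [NeZero N] (Λ : Finset (ZMod N)) (f : ZMod N → ZMod N) :
    ‖1 - (ZMod.stdAddChar (∑ l ∈ Λ, f l) : ℂ)‖ ≤ ∑ l ∈ Λ, ‖1 - (ZMod.stdAddChar (f l) : ℂ)‖ := by
  classical
  induction Λ using Finset.induction_on with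
  | empty => simp
  | insert a s ha ih =>
    rw [Finset.sum_insert ha, Finset.sum_insert ha]
    exact (aux_add N _ _).trans (by gcongr)

theorem aux_zsmul (N : ℕ) [NeZero N] (m : ℤ) (hm : m = -1 ∨ m = 0 ∨ m = 1) (l x : ZMod N) :
    ‖1 - (ZMod.stdAddChar ((m • l) * x) : ℂ)‖ ≤ ‖1 - (ZMod.stdAddChar (l * x) : ℂ)‖ := by
  rcases hm with rfl | rfl | rfl
  · rw [neg_smul, one_smul, neg_mul, aux_neg]
  · simp
  · simp

theorem aux_fourier (N : ℕ) [NeZero N] (Γ : Finset (ZMod N)) (δ : ℝ) (t : ZMod N) :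
    bohrFourier N Γ δ t = ((bohr N Γ δ).card : ℂ)⁻¹ *
      ∑ y ∈ bohr N Γ δ, (ZMod.stdAddChar (-(t * y)) : ℂ) := by
  unfold bohrFourier
  congr 1
  refine Finset.sum_congr rfl fun y _ => ?_
  rw [AddChar.map_neg_eq_inv, ZMod.stdAddChar_apply, ZMod.toCircle_apply, Complex.exp_neg]

theorem aux_card_pos (N : ℕ) [NeZero N] (Γ : Finset (ZMod N)) (δ : ℝ) (hδ : 0 < δ) :
    (0 : ℝ) < (bohr N Γ δ).card := by
  have : (0 : ZMod N) ∈ bohr N Γ δ := by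
    rw [aux_mem]; intro t _; simp [hδ.le]
  exact_mod_cast Finset.card_pos.2 ⟨0, this⟩

theorem aux_fourier_le (N : ℕ) [NeZero N] (Γ : Finset (ZMod N)) (δ : ℝ) (hδ : 0 < δ)
    (t : ZMod N) : ‖bohrFourier N Γ δ t‖ ≤ 1 := by
  have hp := aux_card_pos N Γ δ hδ
  rw [aux_fourier, norm_mul, norm_inv, Complex.norm_natCast, inv_mul_le_iff₀ hp, mul_one]
  refine (norm_sum_le _ _).trans ?_
  simp [aux_norm1]

theorem aux_S (N : ℕ) [NeZero N] (Γ : Finset (ZMod N)) (δ : ℝ)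
    (hδ0 : 0 < δ) (hreg : BohrRegular N Γ δ) (δ' : ℝ) (hδ'0 : 0 < δ') (κ : ℝ) (hκ : 0 < κ)
    (s x : ZMod N) (hs : κ ≤ ‖bohrFourier N Γ δ s‖) (hx : x ∈ bohr N Γ δ') :
    ‖1 - (ZMod.stdAddChar (s * x) : ℂ)‖ ≤ 2 ^ 5 * Γ.card * κ⁻¹ * δ' * δ⁻¹ := by
  classical
  have hp := aux_card_pos N Γ δ hδ0
  have hκ1 : κ ≤ 1 := hs.trans (aux_fourier_le N Γ δ hδ0 s)
  have e1 : 2 ^ 5 * Γ.card * κ⁻¹ * δ' * δ⁻¹ = (2 ^ 5 * (Γ.card * (δ' / δ))) / κ := by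
    field_simp
  rw [e1, le_div_iff₀ hκ]
  have hη0 : 0 < δ' / δ := by positivity
  by_cases hc : (Γ.card : ℝ) * (δ' / δ) ≤ ((2 : ℝ) ^ 4)⁻¹
  · have h2 := (hreg (δ' / δ) (by rwa [abs_of_pos hη0])).2
    rw [abs_of_pos hη0] at h2
    have e2 : (1 + δ' / δ) * δ = δ + δ' := by field_simp
    rw [e2] at h2
    set B := bohr N Γ δ with hB
    set P := bohr N Γ (δ + δ') with hP
    have hBP : B ⊆ P := by
      intro y hy
      rw [hB, aux_mem] at hy
      rw [hP, aux_mem]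
      intro t ht
      linarith [hy t ht]
    set B' := B.image (· + x) with hB'
    have hB'P : B' ⊆ P := by
      intro z hz
      obtain ⟨y, hy, rfl⟩ := Finset.mem_image.1 hz
      rw [hB, aux_mem] at hy
      rw [aux_mem] at hx
      rw [hP, aux_mem]
      intro t ht
      rw [mul_add, map_add]
      exact (norm_add_le _ _).trans (add_le_add (hy t ht) (hx t ht))
    have hcard : B'.card = B.card := Finset.card_image_of_injective _ (add_left_injective x)
    let g : ZMod N → ℂ := fun y => (ZMod.stdAddChar (-(s * y)) : ℂ)
    have hg : ∀ A : Finset (ZMod N), ‖∑ y ∈ A, g y‖ ≤ A.card := by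
      intro A
      refine (norm_sum_le _ _).trans ?_
      simp [g, aux_norm1]
    have hsum' : ∑ y ∈ B', g y = ZMod.stdAddChar (-(s * x)) * ∑ y ∈ B, g y := by
      rw [hB', Finset.sum_image (fun a _ b _ h => add_left_injective x h), Finset.mul_sum]
      refine Finset.sum_congr rfl fun y _ => ?_
      simp only [g]
      rw [← AddChar.map_add_eq_mul]
      congr 1; ring
    have hd1 := Finset.sum_sdiff (f := g) hBP
    have hd2 := Finset.sum_sdiff (f := g) hB'P
    have hk : (1 - ZMod.stdAddChar (-(s * x))) * ∑ y ∈ B, g y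
        = ∑ y ∈ P \ B', g y - ∑ y ∈ P \ B, g y := by
      rw [sub_mul, ← hsum', one_mul]
      linear_combination hd1 - hd2
    have hn : ‖1 - (ZMod.stdAddChar (s * x) : ℂ)‖ * ‖∑ y ∈ B, g y‖ ≤
        2 * ((P.card : ℝ) - B.card) := by
      rw [← aux_neg, ← norm_mul, hk]
      refine (norm_sub_le _ _).trans ?_
      have c1 : ((P \ B).card : ℝ) = P.card - B.card := by
        rw [Finset.card_sdiff_of_subset hBP, Nat.cast_sub (Finset.card_le_card hBP)]
      have c2 : ((P \ B').card : ℝ) = P.card - B.card := by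
        rw [Finset.card_sdiff_of_subset hB'P, Nat.cast_sub (Finset.card_le_card hB'P), hcard]
      linarith [hg (P \ B), hg (P \ B')]
    rw [aux_fourier, norm_mul, norm_inv, Complex.norm_natCast, ← hB,
      inv_mul_eq_div, le_div_iff₀ hp] at hs
    have h3 := mul_le_mul_of_nonneg_left hs (norm_nonneg (1 - (ZMod.stdAddChar (s * x) : ℂ)))
    refine le_of_mul_le_mul_right ?_ hp
    have h4 := h3.trans hn
    nlinarith
  · push Not at hc
    have h1 : ‖1 - (ZMod.stdAddChar (s * x) : ℂ)‖ ≤ 2 := by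
      refine (norm_sub_le _ _).trans ?_
      rw [aux_norm1]; norm_num
    have h2 := mul_le_mul h1 hκ1 hκ.le (by norm_num)
    norm_num at hc
    linarith

/-- **Lemma 2.3 (containment in an intersection of Bohr sets).** Let `B(Γ,δ)` be a regular Bohr
set, `0 < δ' ≤ δ`, `κ, ε > 0`, and let `Λ` be a maximal `S`-dissociated subset of a finite set of
frequencies `ℒ`, where `S = {t : |β̂_{Γ,δ}(t)| ≥ κ}`. Then for every `t ∈ ℒ` and every
`x ∈ B(Γ,δ') ∩ B(Λ,ε)` one has `|1 - e^{2πi t x/N}| ≤ 2⁵|Γ|κ⁻¹δ'δ⁻¹ + 2⁴|Λ|ε`. -/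
theorem maximal_dissociated_bohr_bound (N : ℕ) [NeZero N] (Γ : Finset (ZMod N)) (δ : ℝ)
    (hδ0 : 0 < δ) (hδ1 : δ ≤ 1) (hreg : BohrRegular N Γ δ)
    (δ' : ℝ) (hδ'0 : 0 < δ') (hδ' : δ' ≤ δ) (κ : ℝ) (hκ : 0 < κ) (ε : ℝ) (hε : 0 < ε)
    (L Λ : Finset (ZMod N)) (hΛL : Λ ⊆ L)
    (hdiss : SDissociated {t : ZMod N | κ ≤ ‖bohrFourier N Γ δ t‖} Λ)
    (hmax : ∀ Λ' : Finset (ZMod N), Λ ⊆ Λ' → Λ' ⊆ L →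
      SDissociated {t : ZMod N | κ ≤ ‖bohrFourier N Γ δ t‖} Λ' → Λ' = Λ) :
    ∀ t ∈ L, ∀ x ∈ bohr N Γ δ' ∩ bohr N Λ ε,
      ‖1 - chr N t x‖ ≤ 2 ^ 5 * Γ.card * κ⁻¹ * δ' * δ⁻¹ + 2 ^ 4 * Λ.card * ε := by
  classical
  intro t ht x hx
  obtain ⟨hx1, hx2⟩ := Finset.mem_inter.1 hx
  rw [aux_chr]
  have hΛ : ∀ l ∈ Λ, ‖1 - (ZMod.stdAddChar (l * x) : ℂ)‖ ≤ 2 ^ 4 * ε := by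
    intro l hl
    rw [aux_mem] at hx2
    have h1 := aux_norm N (l * x)
    have h2 := hx2 l hl
    have h3 := Real.pi_le_four
    have h4 := Real.pi_pos
    nlinarith
  by_cases htΛ : t ∈ Λ
  · have hc : (1 : ℝ) ≤ Λ.card := by exact_mod_cast Finset.card_pos.2 ⟨t, htΛ⟩
    have h0 : 0 ≤ 2 ^ 5 * Γ.card * κ⁻¹ * δ' * δ⁻¹ := by positivity
    have := hΛ t htΛ
    nlinarith
  · have hnd : ¬ SDissociated {t : ZMod N | κ ≤ ‖bohrFourier N Γ δ t‖} (insert t Λ) := by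
      intro h
      have := hmax (insert t Λ) (Finset.subset_insert _ _)
        (Finset.insert_subset ht hΛL) h
      exact htΛ (this ▸ Finset.mem_insert_self t Λ)
    unfold SDissociated at hnd
    push Not at hnd
    obtain ⟨m, hm, hmS, l, hl, hl0⟩ := hnd
    rw [Finset.sum_insert htΛ] at hmS
    have hmΛ : ∀ l ∈ Λ, m l = -1 ∨ m l = 0 ∨ m l = 1 :=
      fun l hl => hm l (Finset.mem_insert_of_mem hl)
    have hmt : m t ≠ 0 := by
      intro h0
      rw [h0, zero_smul, zero_add] at hmS
      have hz := hdiss m hmΛ hmS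
      rcases Finset.mem_insert.1 hl with rfl | h
      · exact hl0 h0
      · exact hl0 (hz l h)
    set s := m t • t + ∑ l ∈ Λ, m l • l with hs
    have hS := aux_S N Γ δ hδ0 hreg δ' hδ'0 κ hκ s x hmS hx1
    have hA : ‖1 - (ZMod.stdAddChar ((∑ l ∈ Λ, m l • l) * x) : ℂ)‖ ≤ 2 ^ 4 * Λ.card * ε := by
      rw [Finset.sum_mul]
      refine (aux_sum N _ _).trans ?_
      refine (Finset.sum_le_card_nsmul Λ _ (2 ^ 4 * ε) fun l hl =>
        (aux_zsmul N (m l) (hmΛ l hl) l x).trans (hΛ l hl)).trans ?_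
      rw [nsmul_eq_mul]
      apply le_of_eq
      ring
    have hE : ‖1 - (ZMod.stdAddChar (t * x) : ℂ)‖ =
        ‖1 - (ZMod.stdAddChar ((m t • t) * x) : ℂ)‖ := by
      rcases hm t (Finset.mem_insert_self t Λ) with h | h | h
      · rw [h, neg_smul, one_smul, neg_mul, aux_neg]
      · exact absurd h hmt
      · rw [h, one_smul]
    have hd : (m t • t) * x = s * x + -((∑ l ∈ Λ, m l • l) * x) := by
      rw [hs]; ring
    rw [hE, hd]
    refine (aux_add N _ _).trans ?_
    rw [aux_neg]
    exact add_le_add hS hA
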